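/- Let n ≥ 2 and m ≥ 6, and let W be a social welfare function for n agents over the alternatives [m] that is unanimous, satisfies IIA, and is non-dictatorial. Then there exists T ⊆ [m] with |T| = m−5 such that the social welfare function W_{−T} over the 5 alternatives [m]∖T is unanimous, satisfies IIA, and is non-dictatorial. -/

import Mathlib

/-- A preference over `α`: a strict linear order, given as a relation that is
trichotomous, irreflexive and transitive. `σ.1 a b` means `a` is preferred to `b`. -/
def Pref (α : Type*) : Type _ :=
  {r : α → α → Prop //
    (∀ a b, r a b ∨ a = b ∨ r b a) ∧ (∀ a, ¬ r a a) ∧ (∀ a b c, r a b → r b c → r a c)}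

/-- Restriction `σ_{−B}` of a preference on `Fin m` to the alternatives outside `B`. -/
def restrictPref {m : ℕ} (B : Finset (Fin m)) (σ : Pref (Fin m)) :
    Pref {x : Fin m // x ∉ B} :=
  ⟨fun a b => σ.1 a.1 b.1, by
    obtain ⟨h1, h2, h3⟩ := σ.2
    refine ⟨fun a b => ?_, fun a => h2 a.1, fun a b c => h3 a.1 b.1 c.1⟩
    rcases h1 a.1 b.1 with h | h | h
    · exact Or.inl h
    · exact Or.inr (Or.inl (Subtype.ext h))
    · exact Or.inr (Or.inr h)⟩

/-- Extension `π^{+B}` of a preference `π` on `[m] ∖ B` to all of `Fin m`: it agrees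
with `π` outside `B`, places every alternative outside `B` before every alternative
in `B`, and orders `B` by the natural order on `Fin m`. -/
def extendPref {m : ℕ} (B : Finset (Fin m)) (π : Pref {x : Fin m // x ∉ B}) :
    Pref (Fin m) :=
  ⟨fun a b =>
    if ha : a ∈ B then b ∈ B ∧ a < b
    else if hb : b ∈ B then True
    else π.1 ⟨a, ha⟩ ⟨b, hb⟩, by
    obtain ⟨h1, h2, h3⟩ := π.2
    refine ⟨fun a b => ?_, fun a => ?_, fun a b c => ?_⟩
    · by_cases ha : a ∈ B <;> by_cases hb : b ∈ B <;> simp [ha, hb]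
      · rcases lt_trichotomy a b with h | h | h
        · exact Or.inl h
        · exact Or.inr (Or.inl h)
        · exact Or.inr (Or.inr h)
      · rcases h1 ⟨a, ha⟩ ⟨b, hb⟩ with h | h | h
        · exact Or.inl h
        · exact Or.inr (Or.inl (congrArg Subtype.val h))
        · exact Or.inr (Or.inr h)
    · by_cases ha : a ∈ B <;> simp [ha, h2]
    · by_cases ha : a ∈ B <;> by_cases hb : b ∈ B <;> by_cases hc : c ∈ B <;>
        simp [ha, hb, hc]
      · exact fun hab hbc => lt_trans hab hbc
      · exact fun hab hbc => h3 _ _ _ hab hbc⟩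

/-- `a` is preferred to `b` by every agent implies `a` is preferred to `b` in the
aggregate ranking. -/
def Unanimous {n : ℕ} {α : Type*} (W : (Fin n → Pref α) → Pref α) : Prop :=
  ∀ (R : Fin n → Pref α) (a b : α), (∀ i, (R i).1 a b) → (W R).1 a b

/-- Independence of irrelevant alternatives. -/
def IIA {n : ℕ} {α : Type*} (W : (Fin n → Pref α) → Pref α) : Prop :=
  ∀ (R R' : Fin n → Pref α) (a b : α),
    (∀ i, (R i).1 a b ↔ (R' i).1 a b) → ((W R).1 a b ↔ (W R').1 a b)

/-- Some agent's preference is always reproduced verbatim by `W`. -/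
def Dictatorial {n : ℕ} {α : Type*} (W : (Fin n → Pref α) → Pref α) : Prop :=
  ∃ i : Fin n, ∀ R : Fin n → Pref α, W R = R i

/-- The social welfare function `W_{−B}` over the alternatives `[m] ∖ B`:
`W_{−B}(R₁,…,Rₙ) = W(R₁^{+B},…,Rₙ^{+B})_{−B}`. -/
def Wminus {m n : ℕ} (B : Finset (Fin m))
    (W : (Fin n → Pref (Fin m)) → Pref (Fin m))
    (R : Fin n → Pref {x : Fin m // x ∉ B}) : Pref {x : Fin m // x ∉ B} :=
  restrictPref B (W fun i => extendPref B (R i))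

theorem extendPref_apply {m : ℕ} (B : Finset (Fin m)) (π : Pref {x : Fin m // x ∉ B})
    (a b : {x : Fin m // x ∉ B}) : (extendPref B π).1 a.1 b.1 ↔ π.1 a b := by
  simp [extendPref, a.2, b.2]

theorem Unanimous.wminus {m n : ℕ} {W : (Fin n → Pref (Fin m)) → Pref (Fin m)}
    (hU : Unanimous W) (B : Finset (Fin m)) : Unanimous (Wminus B W) :=
  fun _ a b h => hU _ a.1 b.1 fun i => (extendPref_apply B _ a b).2 (h i)

theorem IIA.wminus {m n : ℕ} {W : (Fin n → Pref (Fin m)) → Pref (Fin m)}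
    (hIIA : IIA W) (B : Finset (Fin m)) : IIA (Wminus B W) :=
  fun _ _ a b h => hIIA _ _ a.1 b.1 fun i =>
    (extendPref_apply B _ a b).trans ((h i).trans (extendPref_apply B _ a b).symm)

/-- Agent `i` dictates the aggregate ranking of `a` against `b`. -/
def Decides {n : ℕ} {α : Type*} (W : (Fin n → Pref α) → Pref α) (i : Fin n) (a b : α) : Prop :=
  ∀ R : Fin n → Pref α, (W R).1 a b ↔ (R i).1 a b

/-- A dictator of `W_{−B}` decides, under `W`, every pair of alternatives outside `B`. -/
theorem IIA.decides_of_wminus_eq {m n : ℕ} {W : (Fin n → Pref (Fin m)) → Pref (Fin m)}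
    (hIIA : IIA W) {B : Finset (Fin m)} {i : Fin n} (hi : ∀ R, Wminus B W R = R i)
    {a b : Fin m} (ha : a ∉ B) (hb : b ∉ B) : Decides W i a b := by
  intro R
  have hagree : (W R).1 a b ↔ (Wminus B W fun j => restrictPref B (R j)).1 ⟨a, ha⟩ ⟨b, hb⟩ :=
    hIIA _ _ a b fun j => (extendPref_apply B (restrictPref B (R j)) ⟨a, ha⟩ ⟨b, hb⟩).symm
  rw [hagree, hi]
  rfl

/-- At most one agent decides a given pair of distinct alternatives. -/
theorem Decides.agent_unique {n : ℕ} {α : Type*} [LinearOrder α]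
    {W : (Fin n → Pref α) → Pref α} {i j : Fin n} {a b : α} (hab : a < b)
    (hi : Decides W i a b) (hj : Decides W j a b) : i = j := by
  by_contra hij
  let up : Pref α := ⟨fun x y => x < y, lt_trichotomy, lt_irrefl, fun _ _ _ => lt_trans⟩
  let down : Pref α := ⟨fun x y => y < x, fun x y => by
    rcases lt_trichotomy x y with h | h | h <;> simp [h], lt_irrefl,
    fun _ _ _ h h' => lt_trans h' h⟩
  have key := (hi fun k => if k = i then up else down).symm.trans
    (hj fun k => if k = i then up else down)
  simp only [if_true, if_neg (Ne.symm hij)] at key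
  exact lt_asymm hab (key.1 hab)

theorem stmt15 (m n : ℕ) (hn : 2 ≤ n) (hm : 6 ≤ m)
    (W : (Fin n → Pref (Fin m)) → Pref (Fin m))
    (hU : Unanimous W) (hIIA : IIA W) (hND : ¬ Dictatorial W) :
    ∃ T : Finset (Fin m), T.card = m - 5 ∧
      Unanimous (Wminus T W) ∧ IIA (Wminus T W) ∧ ¬ Dictatorial (Wminus T W) := by
  by_contra hcon
  have hdict : ∀ T : Finset (Fin m), T.card = m - 5 → Dictatorial (Wminus T W) := fun T hT =>
    by_contra fun h => hcon ⟨T, hT, hU.wminus T, hIIA.wminus T, h⟩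
  obtain ⟨a, b, hab⟩ : ∃ a b : Fin m, a < b :=
    ⟨⟨0, by omega⟩, ⟨1, by omega⟩, by simp [Fin.lt_def]⟩
  have hpair : ∀ c d : Fin m, ∃ i, Decides W i a b ∧ Decides W i c d := by
    intro c d
    obtain ⟨S, hS, hcard⟩ := Finset.exists_superset_card_eq (s := {a, b, c, d}) (n := 5)
      (Finset.card_le_four.trans (by norm_num)) (by simpa using by omega)
    obtain ⟨i, hi⟩ := hdict Sᶜ (by simp [Finset.card_compl, hcard])
    have hout : ∀ x ∈ ({a, b, c, d} : Finset (Fin m)), x ∉ Sᶜ := fun x hx => by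
      simpa using hS hx
    exact ⟨i, hIIA.decides_of_wminus_eq hi (hout a (by simp)) (hout b (by simp)),
      hIIA.decides_of_wminus_eq hi (hout c (by simp)) (hout d (by simp))⟩
  obtain ⟨i, hi, -⟩ := hpair a b
  refine hND ⟨i, fun R => Subtype.ext (funext fun c => funext fun d => propext ?_)⟩
  obtain ⟨j, hj, hcd⟩ := hpair c d
  obtain rfl := hi.agent_unique hab hj
  exact hcd R
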